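/- Let p be a monic real polynomial of degree k > 1 whose k roots z_1,…,z_k are all real, exactly one of which is negative and at most one of which is zero. Let c ≥ 0 and assume the unique root of the (k−1)-st derivative p^{(k−1)} is strictly smaller than −c/k. Suppose there exists z̃ > max{z_1,…,z_k} with p(z̃) = z̃^{k−1}·(z̃ + c). Then p(z) > z^{k−1}·(z + c) for all z > z̃. -/

import Mathlib

theorem Multiset.prod_one_sub_lt_prod_one_sub_mul {t : ℝ} (ht0 : 0 < t) (ht1 : t < 1)
    (s : Multiset ℝ) (hs : ∀ x ∈ s, 0 ≤ x ∧ x < 1) :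
    (∀ x ∈ s, x = 0) ∨
      (0 < (s.map fun x => 1 - x).prod ∧ (s.map fun x => 1 - x).prod < 1 ∧
        (s.map fun x => 1 - x).prod < (s.map fun x => 1 - t * x).prod *
          ((s.map fun x => 1 - x).prod + t * (1 - (s.map fun x => 1 - x).prod))) := by
  induction s using Multiset.induction_on with
  | empty => simp
  | cons y s ih =>
    obtain ⟨hy0, hy1⟩ := hs y (Multiset.mem_cons_self y s)
    have ih := ih fun x hx => hs x (Multiset.mem_cons_of_mem hx)
    simp only [Multiset.map_cons, Multiset.prod_cons, Multiset.mem_cons, forall_eq_or_imp]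
    rcases hy0.eq_or_lt with rfl | hy0
    · simpa using ih
    right
    have hstep : 1 - y < (1 - t * y) * ((1 - y) + t * y) := by
      nlinarith [mul_pos (mul_pos ht0 (sub_pos.2 ht1)) (mul_pos hy0 hy0)]
    rcases ih with h0 | ⟨hP0, hP1, hP⟩
    · have h1 : (s.map fun x => 1 - x).prod = 1 :=
        Multiset.prod_eq_one fun _ hb => by
          obtain ⟨x, hx, rfl⟩ := Multiset.mem_map.1 hb
          simp [h0 x hx]
      have h2 : (s.map fun x => 1 - t * x).prod = 1 :=
        Multiset.prod_eq_one fun _ hb => by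
          obtain ⟨x, hx, rfl⟩ := Multiset.mem_map.1 hb
          simp [h0 x hx]
      rw [h1, h2]
      refine ⟨by linarith, by linarith, by linarith⟩
    · generalize (s.map fun x => 1 - x).prod = P at *
      generalize (s.map fun x => 1 - t * x).prod = R at *
      have hy : 0 < 1 - y := by linarith
      have hty : 0 < 1 - t * y := by nlinarith
      have hD : 0 < P + t * (1 - P) := by nlinarith
      have hR : 0 < R := by
        by_contra! h
        nlinarith
      refine ⟨mul_pos hy hP0, by nlinarith, ?_⟩
      calc (1 - y) * P
          < ((1 - t * y) * ((1 - y) + t * y)) * (R * (P + t * (1 - P))) :=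
            mul_lt_mul'' hstep hP hy.le hP0.le
        _ = ((1 - t * y) * R) * (((1 - y) + t * y) * (P + t * (1 - P))) := by ring
        _ ≤ ((1 - t * y) * R) * ((1 - y) * P + t * (1 - (1 - y) * P)) := by
            refine mul_le_mul_of_nonneg_left ?_ (mul_pos hty hR).le
            nlinarith [mul_pos (mul_pos ht0 (sub_pos.2 ht1)) (mul_pos hy0 (sub_pos.2 hP1))]

theorem Multiset.prod_sub_eq_pow_mul_prod_one_sub_div {v : ℝ} (hv : v ≠ 0) (s : Multiset ℝ) :
    (s.map fun r => v - r).prod = v ^ s.card * (s.map fun r => 1 - r / v).prod := by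
  induction s using Multiset.induction_on with
  | empty => simp
  | cons y s ih =>
    simp only [Multiset.map_cons, Multiset.prod_cons, Multiset.card_cons, ih]
    field_simp
    ring


/-- Lemma 8.5, polynomial comparison lemma: let `p` be a monic real
polynomial of degree `k > 1` with all roots real, exactly one negative root and at most
one zero root. If the unique root of `p^{(k-1)}` is strictly smaller than `-c/k` and if
`p(z̃) = z̃^{k-1}(z̃ + c)` at some point `z̃` strictly larger than all roots of `p`, then
`p(z) > z^{k-1}(z + c)` for all `z > z̃`. -/
theorem stmt19 (k : ℕ) (hk : 1 < k) (p : Polynomial ℝ) (hmonic : p.Monic)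
    (hdeg : p.natDegree = k) (hroots : p.roots.card = k)
    (hneg : (p.roots.filter (fun z => z < 0)).card = 1)
    (hzero : p.roots.count 0 ≤ 1)
    (c : ℝ) (hc : 0 ≤ c)
    (hder : ∀ z : ℝ, (Polynomial.derivative^[k - 1] p).eval z = 0 → z < -c / k)
    (zt : ℝ) (hzt : ∀ r ∈ p.roots, r < zt)
    (hval : p.eval zt = zt ^ (k - 1) * (zt + c)) :
    ∀ z : ℝ, zt < z → z ^ (k - 1) * (z + c) < p.eval z := by
  intro z hz
  obtain ⟨b, hb⟩ := Multiset.card_eq_one.1 hneg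
  set s := p.roots.filter (fun z => ¬ z < 0)
  have hrs : p.roots = b ::ₘ s := by
    rw [← Multiset.filter_add_not (fun z : ℝ => z < 0) p.roots, hb, Multiset.singleton_add]
  have hcard : s.card = k - 1 := by
    rw [hrs, Multiset.card_cons] at hroots
    omega
  have hb0 : b < 0 := by
    have : b ∈ p.roots.filter (fun z => z < 0) := by simp [hb]
    exact (Multiset.mem_filter.1 this).2
  have hs0 : ∀ r ∈ s, 0 ≤ r ∧ r < zt := fun r hr =>
    ⟨not_lt.1 (Multiset.mem_filter.1 hr).2, hzt r (Multiset.mem_filter.1 hr).1⟩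
  have hzt0 : 0 < zt := by
    obtain ⟨r, hr⟩ := Multiset.card_pos_iff_exists_mem.1 (show 0 < s.card by omega)
    exact (hs0 r hr).1.trans_lt (hs0 r hr).2
  have hz0 : 0 < z := hzt0.trans hz
  have hprod : (p.roots.map fun r => Polynomial.X - Polynomial.C r).prod = p :=
    Polynomial.prod_multiset_X_sub_C_of_monic_of_roots_card_eq hmonic (by rw [hroots, hdeg])
  have heval : ∀ v : ℝ, p.eval v = (v - b) * (s.map fun r => v - r).prod := by
    intro v
    conv_lhs => rw [← hprod]
    rw [hrs, Polynomial.eval_multiset_prod]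
    simp
  have heval' : ∀ v : ℝ, 0 < v →
      p.eval v = v ^ (k - 1) * ((v - b) * (s.map fun r => 1 - r / v).prod) := by
    intro v hv
    rw [heval, Multiset.prod_sub_eq_pow_mul_prod_one_sub_div hv.ne', hcard]
    ring
  have hval' : (zt - b) * (s.map fun r => 1 - r / zt).prod = zt + c := by
    rw [heval' zt hzt0] at hval
    exact mul_left_cancel₀ (pow_pos hzt0 _).ne' hval
  rw [heval' z hz0]
  refine mul_lt_mul_of_pos_left ?_ (pow_pos hz0 _)
  have key := Multiset.prod_one_sub_lt_prod_one_sub_mul (div_pos hzt0 hz0)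
    ((div_lt_one hz0).2 hz) (s.map fun r => r / zt) (by
      intro x hx
      obtain ⟨r, hr, rfl⟩ := Multiset.mem_map.1 hx
      exact ⟨div_nonneg (hs0 r hr).1 hzt0.le, (div_lt_one hzt0).2 (hs0 r hr).2⟩)
  have hmul : ∀ r : ℝ, zt / z * (r / zt) = r / z := fun r => by field_simp
  simp only [Multiset.map_map, Function.comp_def, hmul] at key
  rcases key with h0 | ⟨hP0, hP1, hP⟩
  · exfalso
    have hall : ∀ r ∈ s, r = 0 := fun r hr => by
      simpa [hzt0.ne'] using h0 _ (Multiset.mem_map_of_mem _ hr)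
    have hrep : s = Multiset.replicate (k - 1) 0 := Multiset.eq_replicate.2 ⟨hcard, hall⟩
    have hk2 : k = 2 := by
      rw [hrs, hrep, Multiset.count_cons, Multiset.count_replicate_self] at hzero
      omega
    subst hk2
    have hbc : b = -c := by
      rw [hrep] at hval'
      simp at hval'
      linarith
    have hp : p = (Polynomial.X + Polynomial.C c) * Polynomial.X := by
      rw [← hprod, hrs, hrep, hbc]
      simp
    have := hder (-c / (2 : ℕ)) (by
      rw [hp]
      simp
      ring)
    exact lt_irrefl _ this
  · generalize (s.map fun r => 1 - r / zt).prod = P at *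
    generalize (s.map fun r => 1 - r / z).prod = R at *
    have hcb : c < -b := by nlinarith
    have hP' : (zt + c) * z < R * (z * (zt + c) + zt * (-b - c)) := by
      have hfac : R * (z * (zt + c) + zt * (-b - c)) =
          (zt - b) * z * (R * (P + zt / z * (1 - P))) := by
        rw [show -b - c = (zt - b) * (1 - P) by linarith, ← hval']
        field_simp
      rw [hfac, ← hval']
      nlinarith [mul_lt_mul_of_pos_left hP (mul_pos (show 0 < zt - b by linarith) hz0)]
    have hD : 0 < z * (zt + c) + zt * (-b - c) :=
      add_pos (mul_pos hz0 (by linarith)) (mul_pos hzt0 (by linarith))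
    refine lt_of_mul_lt_mul_right ?_ hD.le
    calc (z + c) * (z * (zt + c) + zt * (-b - c))
        ≤ (z - b) * ((zt + c) * z) := by
          nlinarith [mul_nonneg (mul_nonneg hc (sub_pos.2 hz).le) (sub_pos.2 hcb).le]
      _ < (z - b) * (R * (z * (zt + c) + zt * (-b - c))) :=
          mul_lt_mul_of_pos_left hP' (by linarith)
      _ = (z - b) * R * (z * (zt + c) + zt * (-b - c)) := by ring
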